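/- Let θ > 0, let n be a positive integer, let α ∈ (0,1), and let μ = Measure.pi (fun _ : Fin n => Unif(−θ, θ)). Define w̄(w) = max_{i ∈ Fin n} |w i| and the random interval Ŵ(w) = [−w̄(w)·α^{−1/n}, w̄(w)·α^{−1/n}]. Then μ({w : Fin n → ℝ | Set.Icc (−θ) θ ⊆ Ŵ(w)}) = 1 − α. -/

import Mathlib

open MeasureTheory

/-- `unif a b` is the uniform probability measure on the interval `[a, b]`:
`(b - a)⁻¹` times Lebesgue measure restricted to `[a, b]`. -/
noncomputable def unif (a b : ℝ) : Measure ℝ :=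
  (ENNReal.ofReal (b - a))⁻¹ • volume.restrict (Set.Icc a b)

lemma isProbabilityMeasure_unif {a b : ℝ} (hab : a < b) : IsProbabilityMeasure (unif a b) := by
  constructor
  rw [unif, Measure.smul_apply, Measure.restrict_apply_univ, Real.volume_Icc, smul_eq_mul]
  exact ENNReal.inv_mul_cancel (by simpa using hab) ENNReal.ofReal_ne_top

lemma unif_Ioo {a b c d : ℝ} (hab : a < b) (hac : a ≤ c) (hdb : d ≤ b) :
    unif a b (Set.Ioo c d) = ENNReal.ofReal ((d - c) / (b - a)) := by
  have hsub : Set.Ioo c d ⊆ Set.Icc a b :=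
    Set.Ioo_subset_Icc_self.trans (Set.Icc_subset_Icc hac hdb)
  rw [unif, Measure.smul_apply, Measure.restrict_apply measurableSet_Ioo,
    Set.inter_eq_left.mpr hsub, Real.volume_Ioo, smul_eq_mul,
    ENNReal.ofReal_div_of_pos (sub_pos.mpr hab), ENNReal.div_eq_inv_mul]

lemma le_ciSup_abs_iff {ι : Type*} [Finite ι] [Nonempty ι] (w : ι → ℝ) (c : ℝ) :
    c ≤ ⨆ i, |w i| ↔ ∃ i, c ≤ |w i| := by
  constructor
  · intro h
    obtain ⟨i, hi⟩ := exists_eq_ciSup_of_finite (f := fun i => |w i|)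
    exact ⟨i, h.trans_eq hi.symm⟩
  · rintro ⟨i, hi⟩
    exact hi.trans (le_ciSup (f := fun i => |w i|) (Set.finite_range _).bddAbove i)

lemma Icc_neg_subset_Icc_neg_iff {a b : ℝ} (ha : 0 ≤ a) :
    Set.Icc (-a) a ⊆ Set.Icc (-b) b ↔ a ≤ b := by
  rw [Set.Icc_subset_Icc_iff (neg_le_self ha), neg_le_neg_iff, and_self]

/-- **Exact Confidence Support (one-dimensional).** With `w̄ = max_i |w i|` over `n` i.i.d.
`Unif(-θ, θ)` samples, the random interval `Ŵ(w) = [-w̄ · α^{-1/n}, w̄ · α^{-1/n}]` contains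
the true support `[-θ, θ]` with probability exactly `1 - α`. -/
theorem uniform_confidence_support_coverage (θ : ℝ) (hθ : 0 < θ) (n : ℕ) (hn : 0 < n)
    (α : ℝ) (hα : α ∈ Set.Ioo (0 : ℝ) 1) :
    (Measure.pi fun _ : Fin n => unif (-θ) θ)
      {w : Fin n → ℝ |
        Set.Icc (-θ) θ ⊆
          Set.Icc (-((⨆ i, |w i|) * α ^ (-1 / (n : ℝ))))
            ((⨆ i, |w i|) * α ^ (-1 / (n : ℝ)))} =
      ENNReal.ofReal (1 - α) := by
  obtain ⟨hα0, hα1⟩ := hα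
  have : Nonempty (Fin n) := ⟨⟨0, hn⟩⟩
  have hθθ : -θ < θ := neg_lt_self hθ
  have := isProbabilityMeasure_unif hθθ
  set r : ℝ := α ^ ((n : ℝ)⁻¹) with hr
  have hr0 : 0 < r := Real.rpow_pos_of_pos hα0 _
  have hr1 : r ≤ 1 := Real.rpow_le_one hα0.le hα1.le (by positivity)
  have hrn : r ^ n = α := Real.rpow_inv_natCast_pow hα0.le hn.ne'
  have hrinv : α ^ (-1 / (n : ℝ)) = r⁻¹ := by
    rw [neg_div, one_div, Real.rpow_neg hα0.le]
  have hcθ : θ * r ≤ θ := mul_le_of_le_one_right hθ.le hr1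
  have hset : {w : Fin n → ℝ | Set.Icc (-θ) θ ⊆
      Set.Icc (-((⨆ i, |w i|) * α ^ (-1 / (n : ℝ)))) ((⨆ i, |w i|) * α ^ (-1 / (n : ℝ)))} =
      (Set.univ.pi fun _ => Set.Ioo (-(θ * r)) (θ * r))ᶜ := by
    ext w
    rw [Set.mem_ofPred_eq, Icc_neg_subset_Icc_neg_iff hθ.le, hrinv, ← div_eq_mul_inv,
      le_div_iff₀ hr0, le_ciSup_abs_iff]
    simp only [Set.mem_compl_iff, Set.mem_univ_pi, Set.mem_Ioo, ← abs_lt, not_forall, not_lt]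
  have hratio : (θ * r - -(θ * r)) / (θ - -θ) = r := by
    field_simp
  rw [hset, prob_compl_eq_one_sub (MeasurableSet.univ_pi fun _ => measurableSet_Ioo),
    Measure.pi_pi]
  simp only [unif_Ioo hθθ (neg_le_neg hcθ) hcθ, hratio, Finset.prod_const, Finset.card_univ,
    Fintype.card_fin]
  rw [← ENNReal.ofReal_pow hr0.le, hrn, ENNReal.ofReal_sub _ hα0.le, ENNReal.ofReal_one]
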